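/- Let 𝔤 be an affine Lie algebra and λ ∈ 𝔥* with (δ, λ+ρ) ≠ 0. Then the stabilizer {w ∈ W : w∘λ = λ} of λ under the shifted (dot) Weyl group action equals the subgroup W₀(λ) generated by the reflections s_α with α a real root satisfying (α∨, λ+ρ) = 0. -/

import Mathlib

open scoped BigOperators

/-- Abstract data of (the root system of) an affine Lie algebra, living in the
complex dual Cartan `V = 𝔥*`.  `ι` indexes the simple roots. -/
structure AffineRootSystem (ι V : Type*) [Fintype ι] [AddCommGroup V] [Module ℂ V] where
  /-- the normalized invariant symmetric bilinear form `( , )` on `𝔥*` -/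
  B : V →ₗ[ℂ] V →ₗ[ℂ] ℂ
  symm : ∀ x y, B x y = B y x
  /-- the simple roots `α_i` -/
  simple : ι → V
  /-- the set of all roots `Δ` -/
  Δ : Set V
  /-- the set of real roots `Δ_re` -/
  Δre : Set V
  /-- the set of positive roots `Δ⁺` -/
  pos : Set V
  /-- the basic positive imaginary root `δ` -/
  δ : V
  /-- a fixed `ρ` with `(α_i∨, ρ) = 1` -/
  ρ : V
  /-- the integral weight lattice `P` -/
  P : AddSubgroup V
  /-- the reflection `s_α` (as a linear automorphism of `𝔥*`) -/
  reflEquiv : V → (V ≃ₗ[ℂ] V)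
  Δre_sub : Δre ⊆ Δ
  pos_sub : pos ⊆ Δ
  simple_mem : ∀ i, simple i ∈ Δre
  simple_pos : ∀ i, simple i ∈ pos
  δ_ne : δ ≠ 0
  δ_pos : δ ∈ pos
  B_δ_δ : B δ δ = 0
  B_δ_re : ∀ α ∈ Δre, B δ α = 0
  norm_rat_pos : ∀ α ∈ Δre, ∃ q : ℚ, 0 < q ∧ B α α = (q : ℂ)
  pairing_rat : ∀ α ∈ Δre, ∀ β ∈ Δre, ∃ q : ℚ, B α β = (q : ℂ)
  reflEquiv_apply : ∀ α ∈ Δre, ∀ v, reflEquiv α v = v - (B ((2 / B α α) • α) v) • α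
  refl_closed : ∀ α ∈ Δre, ∀ β ∈ Δre, reflEquiv α β ∈ Δre
  neg_mem : ∀ α ∈ Δre, -α ∈ Δre
  pos_or_neg : ∀ α ∈ Δre, α ∈ pos ∨ -α ∈ pos
  not_both : ∀ α ∈ Δre, ¬(α ∈ pos ∧ -α ∈ pos)
  ρ_normalized : ∀ i, B ((2 / B (simple i) (simple i)) • simple i) ρ = 1
  simple_mem_P : ∀ i, simple i ∈ P
  ρ_mem_P : ρ ∈ P
  Δre_sub_P : Δre ⊆ (P : Set V)
  /-- each real root belongs to a `δ`-string of real roots -/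
  string : ∀ α ∈ Δre, ∃ r : ℤ, 0 < r ∧ ∀ n : ℤ, α + (n * r) • δ ∈ Δre
  /-- finitely many classes of real roots modulo `ℤδ` (finiteness of `Δ_cl`) -/
  cl_finite : ∃ F : Finset V, ∀ α ∈ Δre, ∃ γ ∈ F, ∃ n : ℤ, α = γ + n • δ
  /-- the form is positive semidefinite on the rational span of the real roots,
  with radical spanned by `δ` -/
  semidef : ∀ (t : Finset V) (c : V → ℚ), (↑t : Set V) ⊆ Δre →
    ∃ q : ℚ, 0 ≤ q ∧
      B (∑ α ∈ t, (c α : ℂ) • α) (∑ α ∈ t, (c α : ℂ) • α) = (q : ℂ) ∧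
      (q = 0 → ∃ s : ℚ, ∑ α ∈ t, (c α : ℂ) • α = (s : ℂ) • δ)

namespace AffineRootSystem

variable {ι V : Type*} [Fintype ι] [AddCommGroup V] [Module ℂ V]
variable (A : AffineRootSystem ι V)

/-- the coroot `α∨ = 2α/(α,α)` -/
noncomputable def coroot (α : V) : V := (2 / A.B α α) • α

/-- the pairing `(α∨, v)` -/
noncomputable def pair (α v : V) : ℂ := A.B (A.coroot α) v

/-- the reflection `s_α` as a map -/
noncomputable def refl (α v : V) : V := A.reflEquiv α v

/-- a subsystem of `Δ_re`: a subset closed under its own reflections -/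
def IsSubsystem (Δ₁ : Set V) : Prop :=
  Δ₁ ⊆ A.Δre ∧ ∀ α ∈ Δ₁, ∀ β ∈ Δ₁, A.refl α β ∈ Δ₁

/-- the group generated by the reflections in a set of roots -/
noncomputable def weylOf (s : Set V) : Subgroup (V ≃ₗ[ℂ] V) :=
  Subgroup.closure (A.reflEquiv '' s)

/-- the Weyl group `W` -/
noncomputable def W : Subgroup (V ≃ₗ[ℂ] V) := A.weylOf A.Δre

/-- the shifted (dot) action `w ∘ λ = w(λ+ρ) - ρ` -/
noncomputable def dot (w : V ≃ₗ[ℂ] V) (lam : V) : V := w (lam + A.ρ) - A.ρ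

/-- membership in the `ℚ`-span of a subset of `V` -/
def memRatSpan (s : Set V) (v : V) : Prop :=
  ∃ (t : Finset V) (c : V → ℚ), (↑t : Set V) ⊆ s ∧ v = ∑ α ∈ t, (c α : ℂ) • α

/-- membership in the `ℚ_{≥0}`-cone spanned by a subset of `V` -/
def memRatSpanNonneg (s : Set V) (v : V) : Prop :=
  ∃ (t : Finset V) (c : V → ℚ), (↑t : Set V) ⊆ s ∧ (∀ α ∈ t, 0 ≤ c α) ∧
    v = ∑ α ∈ t, (c α : ℂ) • α

/-- the positive part `Δ₁⁺ = Δ₁ ∩ Δ⁺` of a subsystem -/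
def posPart (Δ₁ : Set V) : Set V := Δ₁ ∩ A.pos

/-- the set `Π₁` of simple roots of a subsystem:
`Π₁ = {α ∈ Δ₁⁺ ; s_α(Δ₁⁺ \ {α}) ⊆ Δ₁⁺}` -/
noncomputable def simpleOf (Δ₁ : Set V) : Set V :=
  {α ∈ A.posPart Δ₁ | ∀ β ∈ A.posPart Δ₁ \ {α}, A.refl α β ∈ A.posPart Δ₁}

/-- the integral root system `Δ(λ) = {α ∈ Δ_re ; (α∨, λ+ρ) ∈ ℤ}` -/
noncomputable def Δint (lam : V) : Set V :=
  {α ∈ A.Δre | ∃ n : ℤ, A.pair α (lam + A.ρ) = (n : ℂ)}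

/-- `Δ⁺(λ)` -/
noncomputable def ΔintPos (lam : V) : Set V := A.Δint lam ∩ A.pos

/-- `Δ⁻(λ)` -/
noncomputable def ΔintNeg (lam : V) : Set V := {α ∈ A.Δint lam | -α ∈ A.pos}

/-- `Δ₀(λ) = {α ∈ Δ_re ; (α∨, λ+ρ) = 0}` -/
noncomputable def Δ0 (lam : V) : Set V := {α ∈ A.Δre | A.pair α (lam + A.ρ) = 0}

/-- `Δ₀⁺(λ)` -/
noncomputable def Δ0Pos (lam : V) : Set V := A.Δ0 lam ∩ A.pos

/-- the integral Weyl group `W(λ)` -/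
noncomputable def Wint (lam : V) : Subgroup (V ≃ₗ[ℂ] V) := A.weylOf (A.Δint lam)

/-- the subgroup `W₀(λ)` -/
noncomputable def W0 (lam : V) : Subgroup (V ≃ₗ[ℂ] V) := A.weylOf (A.Δ0 lam)

/-- the dot-orbit of `λ` under `W(λ)` -/
noncomputable def orbit (lam : V) : Set V := {μ | ∃ w ∈ A.Wint lam, μ = A.dot w lam}

/-- `𝒞 = {λ ; (δ, λ+ρ) ≠ 0}` -/
noncomputable def CC : Set V := {lam | A.B A.δ (lam + A.ρ) ≠ 0}

/-- `(α∨, λ+ρ)` is a nonnegative real number -/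
noncomputable def nonnegAt (lam α : V) : Prop :=
  ∃ r : ℝ, 0 ≤ r ∧ A.pair α (lam + A.ρ) = (r : ℂ)

/-- `(α∨, λ+ρ)` is a nonpositive real number -/
noncomputable def nonposAt (lam α : V) : Prop :=
  ∃ r : ℝ, r ≤ 0 ∧ A.pair α (lam + A.ρ) = (r : ℂ)

/-- `𝔥*⁺ = {λ ; (α∨,λ+ρ) ≥ 0 for all α ∈ Δ⁺(λ)}` -/
noncomputable def domP : Set V := {lam | ∀ α ∈ A.ΔintPos lam, A.nonnegAt lam α}

/-- `𝔥*⁻` -/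
noncomputable def domM : Set V := {lam | ∀ α ∈ A.ΔintPos lam, A.nonposAt lam α}

/-- `𝒞⁺` -/
noncomputable def CCp : Set V := A.CC ∩ A.domP

/-- `𝒞⁻` -/
noncomputable def CCm : Set V := A.CC ∩ A.domM

/-- `Δ_J = Δ ∩ Σ_{i ∈ J} ℤ α_i` -/
noncomputable def ΔJ (J : Set ι) : Set V :=
  {α ∈ A.Δ | ∃ c : ι → ℤ, (∀ i, i ∉ J → c i = 0) ∧ α = ∑ i, (c i : ℂ) • A.simple i}

/-- the dominant integral weights `P⁺` -/
noncomputable def Pplus : Set V :=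
  {v | v ∈ A.P ∧ ∀ i, ∃ n : ℤ, 0 ≤ n ∧ A.pair (A.simple i) v = (n : ℂ)}

/-- the rational points `𝔥*_ℚ = ℚ ⊗_ℤ P` -/
noncomputable def ratPoints : Set V :=
  {v | ∃ (t : Finset V) (c : V → ℚ), (↑t : Set V) ⊆ (A.P : Set V) ∧
    v = ∑ α ∈ t, (c α : ℂ) • α}

end AffineRootSystem

namespace AffineRootSystem

variable {ι V : Type*} [Fintype ι] [AddCommGroup V] [Module ℂ V]
variable (A : AffineRootSystem ι V)

/-- the squared length `(α, α)` as a real number -/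
noncomputable def normSq (α : V) : ℝ := (A.B α α).re

variable {A}

lemma ofReal_normSq {α : V} (hα : α ∈ A.Δre) : ((A.normSq α : ℝ) : ℂ) = A.B α α := by
  obtain ⟨q, -, h⟩ := A.norm_rat_pos α hα
  simp [normSq, h]

lemma normSq_pos {α : V} (hα : α ∈ A.Δre) : 0 < A.normSq α := by
  obtain ⟨q, hq, h⟩ := A.norm_rat_pos α hα
  simpa [normSq, h] using hq

lemma B_self_ne {α : V} (hα : α ∈ A.Δre) : A.B α α ≠ 0 := by
  rw [← ofReal_normSq hα]
  exact_mod_cast (normSq_pos hα).ne'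

lemma reflEquiv_eq {α : V} (hα : α ∈ A.Δre) (v : V) :
    A.reflEquiv α v = v - (2 / A.B α α * A.B α v) • α := by
  simp [A.reflEquiv_apply α hα]

lemma reflEquiv_self {α : V} (hα : α ∈ A.Δre) : A.reflEquiv α α = -α := by
  rw [reflEquiv_eq hα, div_mul_cancel₀ _ (B_self_ne hα), two_smul]
  abel

lemma B_reflEquiv {α : V} (hα : α ∈ A.Δre) (x y : V) :
    A.B (A.reflEquiv α x) (A.reflEquiv α y) = A.B x y := by
  have := B_self_ne hα
  simp only [reflEquiv_eq hα, map_sub, map_smul, LinearMap.sub_apply, LinearMap.smul_apply,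
    smul_eq_mul, A.symm x α]
  field_simp
  ring

lemma reflEquiv_mul_self {α : V} (hα : α ∈ A.Δre) :
    A.reflEquiv α * A.reflEquiv α = 1 := by
  ext v
  rw [LinearEquiv.mul_apply, reflEquiv_eq hα v, map_sub, map_smul, reflEquiv_self hα,
    reflEquiv_eq hα v]
  simp

lemma reflEquiv_inv {α : V} (hα : α ∈ A.Δre) : (A.reflEquiv α)⁻¹ = A.reflEquiv α :=
  inv_eq_of_mul_eq_one_left (reflEquiv_mul_self hα)

lemma reflEquiv_smul {α : V} (hα : α ∈ A.Δre) {c : ℂ} (hc : c ≠ 0) (h : c • α ∈ A.Δre) :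
    A.reflEquiv (c • α) = A.reflEquiv α := by
  ext v
  have := B_self_ne hα
  rw [reflEquiv_eq h, reflEquiv_eq hα, smul_smul]
  congr 2
  simp only [map_smul, LinearMap.smul_apply, smul_eq_mul]
  field_simp

lemma reflEquiv_neg {α : V} (hα : α ∈ A.Δre) : A.reflEquiv (-α) = A.reflEquiv α := by
  have h := A.neg_mem α hα
  rw [← neg_one_smul ℂ] at h ⊢
  exact reflEquiv_smul hα (by norm_num) h

/-- A Weyl group element permutes the real roots and preserves the form. -/
lemma W_induction {w : V ≃ₗ[ℂ] V} (hw : w ∈ A.W) :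
    (∀ α ∈ A.Δre, w α ∈ A.Δre) ∧ ∀ x y, A.B (w x) (w y) = A.B x y := by
  induction hw using Subgroup.closure_induction'' with
  | one => simp
  | mem x hx =>
    obtain ⟨α, hα, rfl⟩ := hx
    exact ⟨A.refl_closed α hα, B_reflEquiv hα⟩
  | inv_mem x hx =>
    obtain ⟨α, hα, rfl⟩ := hx
    rw [reflEquiv_inv hα]
    exact ⟨A.refl_closed α hα, B_reflEquiv hα⟩
  | mul x y _ _ hx hy =>
    exact ⟨fun α hα ↦ hx.1 _ (hy.1 α hα), fun u v ↦ (hx.2 _ _).trans (hy.2 _ _)⟩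

lemma reflEquiv_map {w : V ≃ₗ[ℂ] V} (hw : w ∈ A.W) {α : V} (hα : α ∈ A.Δre) :
    A.reflEquiv (w α) * w = w * A.reflEquiv α := by
  obtain ⟨h₁, h₂⟩ := W_induction hw
  ext v
  rw [LinearEquiv.mul_apply, LinearEquiv.mul_apply, reflEquiv_eq (h₁ α hα), reflEquiv_eq hα]
  simp [h₂]

lemma reflEquiv_mem_W {α : V} (hα : α ∈ A.Δre) : A.reflEquiv α ∈ A.W :=
  Subgroup.subset_closure ⟨α, hα, rfl⟩

lemma normSq_map {w : V ≃ₗ[ℂ] V} (hw : w ∈ A.W) (α : V) : A.normSq (w α) = A.normSq α := by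
  rw [normSq, normSq, (W_induction hw).2]

lemma exists_rat_pair {α β : V} (hα : α ∈ A.Δre) (hβ : β ∈ A.Δre) :
    ∃ q : ℚ, 2 / A.B α α * A.B α β = q := by
  obtain ⟨a, -, ha⟩ := A.norm_rat_pos α hα
  obtain ⟨b, hb⟩ := A.pairing_rat α hα β hβ
  exact ⟨2 / a * b, by push_cast [ha, hb]; rfl⟩

/-- Semidefiniteness of the form on the rational plane spanned by two real roots. -/
lemma semidef_sub_smul {α β : V} (hα : α ∈ A.Δre) (hβ : β ∈ A.Δre) (k : ℚ) :
    0 ≤ (A.B (β - (k : ℂ) • α) (β - (k : ℂ) • α)).re ∧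
      ((A.B (β - (k : ℂ) • α) (β - (k : ℂ) • α)).re = 0 →
        ∃ s : ℚ, β - (k : ℂ) • α = (s : ℂ) • A.δ) := by
  classical
  obtain ⟨t, c, ht, hc⟩ : ∃ (t : Finset V) (c : V → ℚ), (↑t : Set V) ⊆ A.Δre ∧
      ∑ γ ∈ t, (c γ : ℂ) • γ = β - (k : ℂ) • α := by
    by_cases hab : α = β
    · refine ⟨{α}, fun _ ↦ 1 - k, by simpa using hα, ?_⟩
      simp [← hab, sub_smul]
    · refine ⟨{α, β}, fun γ ↦ if γ = α then -k else 1, ?_, ?_⟩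
      · simp [Set.insert_subset_iff, hα, hβ]
      · rw [Finset.sum_pair hab]
        simp [Ne.symm hab]
        abel
  obtain ⟨q, h0, hq, h⟩ := A.semidef t c ht
  rw [hc] at hq h
  rw [hq]
  simpa using ⟨h0, h⟩

/-- Real roots of bounded height relative to a functional `p` with `p δ = 1`. -/
lemma finite_setOf_height_lt (p : V →ₗ[ℝ] ℝ) (hδ : p A.δ = 1) (α : V) (hα : α ∈ A.Δre) :
    {β ∈ A.Δre | p β ^ 2 * A.normSq α < p α ^ 2 * A.normSq β}.Finite := by
  obtain ⟨F, hF⟩ := A.cl_finite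
  refine Set.Finite.subset (F.finite_toSet.biUnion fun γ _ ↦
    ((Set.finite_Icc
      (⌊-p γ - (p α ^ 2 * A.normSq γ / A.normSq α + 1)⌋)
      (⌈-p γ + (p α ^ 2 * A.normSq γ / A.normSq α + 1)⌉)).image fun n : ℤ ↦ γ + n • A.δ)) ?_
  rintro β ⟨hβ, hlt⟩
  obtain ⟨γ, hγ, n, rfl⟩ := hF β hβ
  have hn : A.normSq (γ + n • A.δ) = A.normSq γ := by
    have h := A.B_δ_re _ hβ
    simp only [map_add, map_zsmul, A.B_δ_δ, smul_zero, add_zero] at h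
    simp [normSq, h, A.symm γ A.δ, A.B_δ_δ]
  have ha := normSq_pos hα
  rw [hn, map_add, map_zsmul, hδ, zsmul_one, ← lt_div_iff₀ ha] at hlt
  simp only [Set.mem_iUnion, Set.mem_image, Set.mem_Icc]
  refine ⟨γ, hγ, n, ⟨?_, ?_⟩, rfl⟩
  · have h : -p γ - (p α ^ 2 * A.normSq γ / A.normSq α + 1) ≤ n := by nlinarith
    exact_mod_cast (Int.floor_le _).trans h
  · have h : (n : ℝ) ≤ -p γ + (p α ^ 2 * A.normSq γ / A.normSq α + 1) := by nlinarith
    exact_mod_cast h.trans (Int.le_ceil _)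

/-- A root that is simple for the chamber of `p`: its reflection keeps all other `p`-positive
real roots positive. -/
def IsSimple (A : AffineRootSystem ι V) (p : V →ₗ[ℝ] ℝ) (α : V) : Prop :=
  α ∈ A.Δre ∧ 0 < p α ∧
    ∀ β ∈ A.Δre, 0 < p β → p (A.reflEquiv α β) < 0 → A.reflEquiv β = A.reflEquiv α

/-- If `s_α` makes the positive roots `β` and `γ = -s_α β` negative, `s_β ≠ s_α` and `β` is not
higher than `γ`, then `s_β` lowers `α`. -/
lemma height_reflEquiv_lt (p : V →ₗ[ℝ] ℝ) (hδ : p A.δ = 1) {α β : V} (hα : α ∈ A.Δre)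
    (hβ : β ∈ A.Δre) (hpα : 0 < p α) (hpβ : 0 < p β) (hne : A.reflEquiv β ≠ A.reflEquiv α)
    (hneg : p (A.reflEquiv α β) < 0) (hle : p β ≤ -p (A.reflEquiv α β)) :
    p β ^ 2 * A.normSq α < p α ^ 2 * A.normSq β ∧ |p (A.reflEquiv β α)| < p α := by
  obtain ⟨k, hk⟩ := exists_rat_pair hα hβ
  obtain ⟨k', hk'⟩ := exists_rat_pair hβ hα
  have ha := normSq_pos hα
  have hb := normSq_pos hβ
  have hBα := B_self_ne hα
  have hBβ := B_self_ne hβ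
  have pq (q : ℚ) (x : V) : p ((q : ℂ) • x) = q * p x := by
    have : (q : ℂ) • x = (q : ℝ) • x := by
      rw [← Complex.coe_smul]; simp
    rw [this, map_smul, smul_eq_mul]
  have hαβ : A.B α β = k * A.B α α / 2 := by rw [← hk]; field_simp
  have e₁ : (k' : ℝ) * A.normSq β = k * A.normSq α := by
    have : (k' : ℂ) * A.B β β = k * A.B α α := by
      rw [← hk, ← hk', A.symm β α]; field_simp
    rw [← ofReal_normSq hα, ← ofReal_normSq hβ] at this
    exact_mod_cast this
  rw [reflEquiv_eq hα, hk, map_sub, pq] at hneg hle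
  rw [reflEquiv_eq hβ, hk', map_sub, pq]
  obtain ⟨h0, hs⟩ := semidef_sub_smul hα hβ (k / 2)
  have e₂ : (A.B (β - ((k / 2 : ℚ) : ℂ) • α) (β - ((k / 2 : ℚ) : ℂ) • α)).re =
      A.normSq β - k ^ 2 * A.normSq α / 4 := by
    have : A.B (β - ((k / 2 : ℚ) : ℂ) • α) (β - ((k / 2 : ℚ) : ℂ) • α) =
        ((A.normSq β - k ^ 2 * A.normSq α / 4 : ℝ) : ℂ) := by
      push_cast
      simp only [ofReal_normSq hα, ofReal_normSq hβ, map_sub, map_smul, LinearMap.sub_apply,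
        LinearMap.smul_apply, smul_eq_mul, A.symm β α, hαβ]
      ring
    rw [this, Complex.ofReal_re]
  rw [e₂] at h0 hs
  have hkpos : (0 : ℝ) < k := by
    by_contra! h
    nlinarith
  have hstrict : p β ^ 2 * A.normSq α < p α ^ 2 * A.normSq β := by
    have h1 : p β ≤ k / 2 * p α := by linarith
    have h2 : p β ^ 2 ≤ (k / 2 * p α) ^ 2 := by gcongr
    have h3 : p β ^ 2 * A.normSq α ≤ (k / 2 * p α) ^ 2 * A.normSq α := by gcongr
    have h4 : 0 ≤ p α ^ 2 * (A.normSq β - k ^ 2 * A.normSq α / 4) := by positivity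
    by_contra! hcon
    have h5 : p α ^ 2 * (A.normSq β - k ^ 2 * A.normSq α / 4) = 0 := by nlinarith
    have h6 := (mul_eq_zero.mp h5).resolve_left (by positivity)
    obtain ⟨s, hs⟩ := hs h6
    have h7 : p β = k / 2 * p α := by
      have : p β ^ 2 = (k / 2 * p α) ^ 2 := by
        apply mul_right_cancel₀ ha.ne'
        nlinarith
      exact (pow_left_inj₀ hpβ.le (by positivity) two_ne_zero).mp this
    have h8 := congrArg p hs
    rw [map_sub, pq, pq, hδ, h7] at h8
    push_cast at h8
    have hs0 : s = 0 := by
      have : (s : ℝ) = 0 := by linarith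
      exact_mod_cast this
    rw [hs0, Rat.cast_zero, zero_smul, sub_eq_zero] at hs
    have hk0 : ((k / 2 : ℚ) : ℂ) ≠ 0 := by
      have : k ≠ 0 := by rintro rfl; simp at hkpos
      exact_mod_cast div_ne_zero this two_ne_zero
    exact hne (hs ▸ reflEquiv_smul hα hk0 (hs ▸ hβ))
  refine ⟨hstrict, ?_⟩
  have hk'pos : (0 : ℝ) < k' := by
    by_contra! h
    nlinarith [mul_pos hkpos ha]
  have hlt : k' * p β < 2 * p α := by
    refine lt_of_pow_lt_pow_left₀ 2 (by positivity) ?_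
    have hkk : k * k' ≤ (4 : ℝ) := by
      refine le_of_mul_le_mul_right ?_ hb
      nlinarith
    have h1 : k' ^ 2 * (p β ^ 2 * A.normSq α) < k' ^ 2 * (p α ^ 2 * A.normSq β) := by gcongr
    have h2 : k' ^ 2 * (p α ^ 2 * A.normSq β) = k * k' * (p α ^ 2 * A.normSq α) := by
      linear_combination k' * p α ^ 2 * e₁
    have h3 : k * k' * (p α ^ 2 * A.normSq α) ≤ 4 * (p α ^ 2 * A.normSq α) := by gcongr
    refine lt_of_mul_lt_mul_right ?_ ha.le
    nlinarith
  rw [abs_lt]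
  constructor
  · linarith
  · nlinarith [mul_pos hk'pos hpβ]

/-- The reflections in `p`-simple roots generate all reflections. -/
lemma reflEquiv_mem_weylOf_isSimple (p : V →ₗ[ℝ] ℝ) (hδ : p A.δ = 1)
    (hp : ∀ α ∈ A.Δre, p α ≠ 0) {α : V} (hα : α ∈ A.Δre) :
    A.reflEquiv α ∈ A.weylOf {β | A.IsSimple p β} := by
  induction hn : {β ∈ A.Δre | p β ^ 2 * A.normSq α < p α ^ 2 * A.normSq β}.ncard
    using Nat.strong_induction_on generalizing α with
  | _ n ih =>
  subst hn
  wlog hpα : 0 < p α generalizing α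
  · rw [← reflEquiv_neg hα]
    refine this (A.neg_mem α hα) (fun m hm β hβ e ↦ ih m ?_ hβ e) ?_
    · simpa [normSq] using hm
    · rw [map_neg]
      exact neg_pos.mpr ((not_lt.mp hpα).lt_of_ne (hp α hα))
  have low {β : V} (hβ : β ∈ A.Δre)
      (hlt : p β ^ 2 * A.normSq α < p α ^ 2 * A.normSq β) :
      A.reflEquiv β ∈ A.weylOf {β | A.IsSimple p β} := by
    refine ih _ (Set.ncard_lt_ncard ?_ (finite_setOf_height_lt p hδ α hα)) hβ rfl
    refine ⟨?_, fun hsub ↦ lt_irrefl _ (hsub ⟨hβ, hlt⟩).2⟩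
    rintro γ ⟨hγ, h⟩
    refine ⟨hγ, ?_⟩
    have hb := normSq_pos hβ
    have ha := normSq_pos hα
    have hg := normSq_pos hγ
    refine lt_of_mul_lt_mul_right ?_ hb.le
    have h1 := mul_lt_mul_of_pos_right h ha
    have h2 := mul_lt_mul_of_pos_right hlt hg
    nlinarith
  have step {β : V} (hβ : β ∈ A.Δre) (hpβ : 0 < p β) (hne : A.reflEquiv β ≠ A.reflEquiv α)
      (hneg : p (A.reflEquiv α β) < 0) (hle : p β ≤ -p (A.reflEquiv α β)) :
      A.reflEquiv α ∈ A.weylOf {β | A.IsSimple p β} := by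
    obtain ⟨h₁, h₂⟩ := height_reflEquiv_lt p hδ hα hβ hpα hpβ hne hneg hle
    have hβm := low hβ h₁
    have hW := reflEquiv_mem_W hβ
    have hγm : A.reflEquiv (A.reflEquiv β α) ∈ A.weylOf {β | A.IsSimple p β} := by
      refine low (A.refl_closed β hβ α hα) ?_
      rw [normSq_map hW]
      refine mul_lt_mul_of_pos_right ?_ (normSq_pos hα)
      exact sq_lt_sq.mpr (h₂.trans_le (le_abs_self _))
    have : A.reflEquiv α = (A.reflEquiv β)⁻¹ * A.reflEquiv (A.reflEquiv β α) * A.reflEquiv β := by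
      rw [mul_assoc, reflEquiv_map hW hα, inv_mul_cancel_left]
    rw [this]
    exact mul_mem (mul_mem (inv_mem hβm) hγm) hβm
  by_cases hs : A.IsSimple p α
  · exact Subgroup.subset_closure ⟨α, hs, rfl⟩
  simp only [IsSimple, not_and, not_forall] at hs
  obtain ⟨β, hβ, hpβ, hneg, hne⟩ := hs hα hpα
  rcases le_total (p β) (-p (A.reflEquiv α β)) with hle | hle
  · exact step hβ hpβ hne hneg hle
  have hW := reflEquiv_mem_W hα
  have hγ := A.refl_closed α hα β hβ
  have hinv : A.reflEquiv α (A.reflEquiv α β) = β :=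
    LinearEquiv.congr_fun (reflEquiv_mul_self hα) β
  refine step (A.neg_mem _ hγ) ?_ ?_ ?_ ?_
  · rw [map_neg]; linarith
  · rw [reflEquiv_neg hγ]
    intro h
    have h1 := reflEquiv_map hW hβ
    rw [h] at h1
    exact hne (mul_left_cancel h1).symm
  · rw [map_neg, hinv, map_neg]; linarith
  · rwa [map_neg, map_neg, hinv, map_neg, neg_neg]

lemma exists_word (p : V →ₗ[ℝ] ℝ) (hδ : p A.δ = 1) (hp : ∀ α ∈ A.Δre, p α ≠ 0)
    {w : V ≃ₗ[ℂ] V} (hw : w ∈ A.W) :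
    ∃ l : List V, (∀ α ∈ l, A.IsSimple p α) ∧ (l.map A.reflEquiv).prod = w := by
  have hle : A.W ≤ A.weylOf {β | A.IsSimple p β} := by
    refine (Subgroup.closure_le _).mpr ?_
    rintro _ ⟨α, hα, rfl⟩
    exact reflEquiv_mem_weylOf_isSimple p hδ hp hα
  replace hw := hle hw
  have base {x : V ≃ₗ[ℂ] V} (hx : x ∈ A.reflEquiv '' {β | A.IsSimple p β}) :
      ∃ l : List V, (∀ α ∈ l, A.IsSimple p α) ∧ (l.map A.reflEquiv).prod = x := by
    obtain ⟨α, hα, rfl⟩ := hx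
    exact ⟨[α], by simpa using hα, by simp⟩
  induction hw using Subgroup.closure_induction'' with
  | one => exact ⟨[], by simp⟩
  | mem x hx => exact base hx
  | inv_mem x hx =>
    obtain ⟨α, hα, rfl⟩ := hx
    rw [reflEquiv_inv hα.1]
    exact base ⟨α, hα, rfl⟩
  | mul x y _ _ hx hy =>
    obtain ⟨l, hl, rfl⟩ := hx
    obtain ⟨m, hm, rfl⟩ := hy
    exact ⟨l ++ m, by simpa [or_imp, forall_and] using ⟨hl, hm⟩, by simp⟩

lemma word_mem_W {p : V →ₗ[ℝ] ℝ} {l : List V} (hl : ∀ α ∈ l, A.IsSimple p α) :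
    (l.map A.reflEquiv).prod ∈ A.W := by
  refine Subgroup.list_prod_mem _ fun x hx ↦ ?_
  obtain ⟨α, hα, rfl⟩ := List.mem_map.mp hx
  exact reflEquiv_mem_W (hl α hα).1

/-- The exchange property. -/
lemma exchange {p : V →ₗ[ℝ] ℝ} (hp : ∀ α ∈ A.Δre, p α ≠ 0) {α : V} (hα : A.IsSimple p α)
    {l : List V} (hl : ∀ α ∈ l, A.IsSimple p α) (hneg : p ((l.map A.reflEquiv).prod α) < 0) :
    ∃ m : List V, (∀ α ∈ m, A.IsSimple p α) ∧ m.length < l.length ∧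
      (m.map A.reflEquiv).prod = (l.map A.reflEquiv).prod * A.reflEquiv α := by
  induction l with
  | nil => exact absurd hneg hα.2.1.not_gt
  | cons β t ih =>
    have ht : ∀ α ∈ t, A.IsSimple p α := fun γ hγ ↦ hl γ (List.mem_cons_of_mem _ hγ)
    have hβ := hl β List.mem_cons_self
    have hW := word_mem_W ht
    have hroot := (W_induction hW).1 α hα.1
    rcases (hp _ hroot).lt_or_gt with h | h
    · obtain ⟨m, hm, hlen, e⟩ := ih ht h
      refine ⟨β :: m, ?_, by simpa using hlen, by simp [e, mul_assoc]⟩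
      simpa using ⟨hβ, hm⟩
    · refine ⟨t, ht, by simp, ?_⟩
      rw [List.map_cons, List.prod_cons] at hneg ⊢
      rw [mul_assoc, ← reflEquiv_map hW hα.1, hβ.2.2 _ hroot h hneg, ← mul_assoc,
        reflEquiv_mul_self hβ.1, one_mul]

lemma reflEquiv_fix {α v : V} (hα : α ∈ A.Δre) (h : A.B α v = 0) : A.reflEquiv α v = v := by
  simp [reflEquiv_eq hα, h]

/-- If `v` lies in the closed chamber of `p`, its stabilizer in the Weyl group is generated by
reflections. -/
lemma mem_weylOf_of_fix (p : V →ₗ[ℝ] ℝ) (hp : ∀ α ∈ A.Δre, p α ≠ 0) (v : V)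
    (hdom : ∀ α ∈ A.Δre, ∀ β ∈ A.Δre, 0 < p α → p β < 0 → A.B α v = A.B β v → A.B α v = 0)
    {l : List V} (hl : ∀ α ∈ l, A.IsSimple p α) (hfix : (l.map A.reflEquiv).prod v = v) :
    (l.map A.reflEquiv).prod ∈ A.weylOf {α ∈ A.Δre | A.B α v = 0} := by
  induction hn : l.length using Nat.strong_induction_on generalizing l with
  | _ n ih =>
  subst hn
  rcases List.eq_nil_or_concat l with rfl | ⟨t, α, rfl⟩
  · simp [one_mem]
  rw [List.concat_eq_append] at *
  have ht : ∀ α ∈ t, A.IsSimple p α := fun γ hγ ↦ hl γ (by simp [hγ])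
  have hα := hl α (by simp)
  have hW := word_mem_W ht
  have hroot := (W_induction hW).1 α hα.1
  have hprod : ((t ++ [α]).map A.reflEquiv).prod =
      (t.map A.reflEquiv).prod * A.reflEquiv α := by simp
  rcases (hp _ hroot).lt_or_gt with h | h
  · obtain ⟨m, hm, hlen, e⟩ := exchange hp hα ht h
    rw [hprod, ← e] at hfix ⊢
    exact ih _ (by simp; omega) hm hfix rfl
  · rw [hprod] at hfix ⊢
    have hzero : A.B α v = 0 := by
      refine hdom α hα.1 _ (A.neg_mem _ hroot) hα.2.1 (by simpa using h) ?_
      conv_lhs => rw [← (W_induction (mul_mem hW (reflEquiv_mem_W hα.1))).2, hfix]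
      rw [LinearEquiv.mul_apply, reflEquiv_self hα.1, map_neg]
    rw [LinearEquiv.mul_apply, reflEquiv_fix hα.1 hzero] at hfix
    exact mul_mem (ih _ (by simp) ht hfix rfl) (Subgroup.subset_closure ⟨α, ⟨hα.1, hzero⟩, rfl⟩)

open Filter Topology in
/-- Small perturbations do not change the strict signs on `x + ℤ`. -/
lemma eventually_sign_perturb (x y : ℝ) : ∀ᶠ ε in 𝓝[>] (0 : ℝ), ∀ n : ℤ,
    (0 < x + n → 0 < x + n + ε * y) ∧ (x + n < 0 → x + n + ε * y < 0) := by
  have lim (c : ℝ) : Tendsto (fun ε : ℝ ↦ c + ε * y) (𝓝[>] 0) (𝓝 c) := by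
    have : Continuous fun ε : ℝ ↦ c + ε * y := by fun_prop
    simpa using (this.tendsto 0).mono_left nhdsWithin_le_nhds
  have h₁ : 0 < x + (⌊-x⌋ + 1) := by linarith [Int.lt_floor_add_one (-x)]
  have h₂ : x + (⌈-x⌉ - 1) < 0 := by linarith [Int.ceil_lt_add_one (-x)]
  filter_upwards [(lim _).eventually_const_lt h₁, (lim _).eventually_lt_const h₂] with ε e₁ e₂ n
  constructor <;> intro hn
  · have : ⌊-x⌋ + 1 ≤ n := Int.floor_lt.mpr (by linarith)
    have : (⌊-x⌋ + 1 : ℝ) ≤ n := by exact_mod_cast this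
    linarith
  · have : n ≤ ⌈-x⌉ - 1 := Int.le_sub_one_of_lt (Int.lt_ceil.mpr (by linarith))
    have : (n : ℝ) ≤ ⌈-x⌉ - 1 := by exact_mod_cast this
    linarith

open Filter Topology in
lemma exists_sign_perturb (G : Finset V) (f g : V →ₗ[ℝ] ℝ) :
    ∃ ε : ℝ, 0 < ε ∧ ∀ γ ∈ G, ∀ n : ℤ,
      (0 < f γ + n → 0 < f γ + n + ε * g γ) ∧ (f γ + n < 0 → f γ + n + ε * g γ < 0) := by
  have h : ∀ᶠ ε in 𝓝[>] (0 : ℝ), ∀ γ ∈ G, ∀ n : ℤ,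
      (0 < f γ + n → 0 < f γ + n + ε * g γ) ∧ (f γ + n < 0 → f γ + n + ε * g γ < 0) :=
    (Finset.eventually_all G).mpr fun γ _ ↦ eventually_sign_perturb _ _
  obtain ⟨ε, hε, h⟩ := (eventually_mem_nhdsWithin.and h).exists
  exact ⟨ε, hε, h⟩

lemma exists_functional_ne_zero (A : AffineRootSystem ι V) :
    ∃ h : V →ₗ[ℝ] ℝ, h A.δ = 0 ∧ ∀ α ∈ A.Δre, h α ≠ 0 := by
  classical
  obtain ⟨F, hF⟩ := A.cl_finite
  set D : Submodule ℝ V := ℝ ∙ A.δ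
  obtain ⟨f, hf⟩ := Module.exists_dual_forall_apply_ne_zero (K := ℝ)
    (fun γ : {γ // γ ∈ F.filter (· ∉ D)} ↦ D.mkQ γ.1) (fun γ ↦ by
      rw [Ne, Submodule.mkQ_apply, Submodule.Quotient.mk_eq_zero]
      exact (Finset.mem_filter.mp γ.2).2)
  have hδ : (Submodule.Quotient.mk A.δ : V ⧸ D) = 0 :=
    (Submodule.Quotient.mk_eq_zero _).mpr (Submodule.mem_span_singleton_self _)
  refine ⟨f ∘ₗ D.mkQ, by simp [hδ], fun α hα ↦ ?_⟩
  obtain ⟨γ, hγ, n, rfl⟩ := hF α hα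
  have hγD : γ ∉ D := by
    intro hmem
    obtain ⟨r, rfl⟩ := Submodule.mem_span_singleton.mp hmem
    refine B_self_ne hα ?_
    rw [← Complex.coe_smul]
    simp [A.B_δ_δ]
  have := hf ⟨γ, Finset.mem_filter.mpr ⟨hγ, hγD⟩⟩
  simpa [hδ] using this

/-- For `v` with `(δ, v) ≠ 0` there is a generic chamber whose closure contains `v`. -/
lemma exists_chamber (v : V) (hv : A.B A.δ v ≠ 0) :
    ∃ p : V →ₗ[ℝ] ℝ, p A.δ = 1 ∧ (∀ α ∈ A.Δre, p α ≠ 0) ∧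
      ∀ α ∈ A.Δre, ∀ β ∈ A.Δre, 0 < p α → p β < 0 → A.B α v = A.B β v → A.B α v = 0 := by
  classical
  obtain ⟨h, hδ, hh⟩ := exists_functional_ne_zero A
  obtain ⟨F, hF⟩ := A.cl_finite
  set c := A.B A.δ v
  set f : V →ₗ[ℂ] ℂ := c⁻¹ • A.B.flip v with hfdef
  have hf (x : V) : f x = c⁻¹ * A.B x v := by simp [hfdef]
  have hfδ : f A.δ = 1 := by rw [hf]; exact inv_mul_cancel₀ hv
  set fR : V →ₗ[ℝ] ℝ := Complex.reLm ∘ₗ f.restrictScalars ℝ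
  set fI : V →ₗ[ℝ] ℝ := Complex.imLm ∘ₗ f.restrictScalars ℝ
  have hR (x : V) : fR x = (f x).re := rfl
  have hI (x : V) : fI x = (f x).im := rfl
  obtain ⟨ε, hε, H⟩ := exists_sign_perturb F fI h
  set g : V →ₗ[ℝ] ℝ := fI + ε • h
  obtain ⟨η, hη, K⟩ := exists_sign_perturb F fR g
  have hg (x : V) : g x = fI x + ε * h x := rfl
  set p : V →ₗ[ℝ] ℝ := fR + η • g
  have hp (x : V) : p x = fR x + η * g x := rfl
  have hRδ : fR A.δ = 1 := by simp [hR, hfδ]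
  have hIδ : fI A.δ = 0 := by simp [hI, hfδ]
  have hgδ : g A.δ = 0 := by simp [hg, hIδ, hδ]
  have sg (α : V) (hα : α ∈ A.Δre) : (0 < fI α → 0 < g α) ∧ (fI α < 0 → g α < 0) := by
    obtain ⟨γ, hγ, n, rfl⟩ := hF α hα
    simpa [hg, hIδ, hδ] using H γ hγ 0
  have sp (α : V) (hα : α ∈ A.Δre) : (0 < fR α → 0 < p α) ∧ (fR α < 0 → p α < 0) := by
    obtain ⟨γ, hγ, n, rfl⟩ := hF α hα
    simpa [hp, hRδ, hgδ] using K γ hγ n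
  have hg0 (α : V) (hα : α ∈ A.Δre) : g α ≠ 0 := by
    rcases lt_trichotomy (fI α) 0 with h0 | h0 | h0
    · exact ((sg α hα).2 h0).ne
    · rw [hg, h0, zero_add]
      exact mul_ne_zero hε.ne' (hh α hα)
    · exact ((sg α hα).1 h0).ne'
  refine ⟨p, by simp [hp, hRδ, hgδ], fun α hα ↦ ?_, fun α hα β hβ hpα hpβ e ↦ ?_⟩
  · rcases lt_trichotomy (fR α) 0 with h0 | h0 | h0
    · exact ((sp α hα).2 h0).ne
    · rw [hp, h0, zero_add]
      exact mul_ne_zero hη.ne' (hg0 α hα)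
    · exact ((sp α hα).1 h0).ne'
  · have e' : f α = f β := by rw [hf, hf, e]
    have eR : fR β = fR α := by rw [hR, hR, e']
    have eI : fI β = fI α := by rw [hI, hI, e']
    have r0 : fR α = 0 := by
      refine le_antisymm (not_lt.mp fun h0 ↦ ?_) (not_lt.mp fun h0 ↦ ?_)
      · exact hpβ.not_gt ((sp β hβ).1 (eR ▸ h0))
      · exact hpα.not_gt ((sp α hα).2 h0)
    have i0 : fI α = 0 := by
      rw [hp, r0, zero_add] at hpα
      rw [hp, eR, r0, zero_add] at hpβ
      have gα : 0 < g α := pos_of_mul_pos_right hpα hη.le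
      have gβ : g β < 0 := neg_of_mul_neg_right hpβ hη.le
      refine le_antisymm (not_lt.mp fun h0 ↦ ?_) (not_lt.mp fun h0 ↦ ?_)
      · exact gβ.not_gt ((sg β hβ).1 (eI ▸ h0))
      · exact gα.not_gt ((sg α hα).2 h0)
    have : f α = 0 := Complex.ext r0 i0
    rw [hf] at this
    exact (mul_eq_zero.mp this).resolve_left (inv_ne_zero hv)

lemma Δ0_eq (A : AffineRootSystem ι V) (lam : V) :
    A.Δ0 lam = {α ∈ A.Δre | A.B α (lam + A.ρ) = 0} := by
  ext α
  refine and_congr_right fun hα ↦ ?_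
  simp only [pair, coroot, map_smul, LinearMap.smul_apply, smul_eq_mul]
  exact mul_eq_zero_iff_left (div_ne_zero two_ne_zero (B_self_ne hα))

lemma dot_eq_self_iff (w : V ≃ₗ[ℂ] V) (lam : V) :
    A.dot w lam = lam ↔ w (lam + A.ρ) = lam + A.ρ :=
  sub_eq_iff_eq_add

end AffineRootSystem

/-- For `λ` with `(δ,λ+ρ) ≠ 0`, the stabilizer of `λ` in `W`
under the dot action equals the subgroup `W₀(λ)` generated by the reflections
`s_α` with `(α∨, λ+ρ) = 0`. -/
theorem statement8 {ι V : Type*} [Fintype ι] [AddCommGroup V] [Module ℂ V]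
    (A : AffineRootSystem ι V) (lam : V) (h : lam ∈ A.CC) :
    {w : V ≃ₗ[ℂ] V | w ∈ A.W ∧ A.dot w lam = lam} =
      ((A.W0 lam : Subgroup (V ≃ₗ[ℂ] V)) : Set (V ≃ₗ[ℂ] V)) := by
  ext w
  simp only [Set.mem_ofPred_eq, SetLike.mem_coe, AffineRootSystem.dot_eq_self_iff]
  constructor
  · rintro ⟨hw, hfix⟩
    obtain ⟨p, hδ, hp, hdom⟩ := AffineRootSystem.exists_chamber (lam + A.ρ) h
    obtain ⟨l, hl, rfl⟩ := AffineRootSystem.exists_word p hδ hp hw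
    rw [AffineRootSystem.W0, AffineRootSystem.Δ0_eq]
    exact AffineRootSystem.mem_weylOf_of_fix p hp _ hdom hl hfix
  · intro hw
    refine ⟨Subgroup.closure_mono (Set.image_mono fun α hα ↦ hα.1) hw, ?_⟩
    rw [AffineRootSystem.W0, AffineRootSystem.Δ0_eq] at hw
    have hle : A.weylOf {α ∈ A.Δre | A.B α (lam + A.ρ) = 0} ≤
        MulAction.stabilizer (V ≃ₗ[ℂ] V) (lam + A.ρ) := by
      refine (Subgroup.closure_le _).mpr ?_
      rintro _ ⟨α, ⟨hα, h0⟩, rfl⟩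
      exact AffineRootSystem.reflEquiv_fix hα h0
    exact hle hw
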